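/- Let G be a finitely presentable group which has a subgroup H of finite index d ≥ 2 such that H is isomorphic to G. Then T_∞(G) = 0. -/

import Mathlib

/-- The set of values `Σ_i max(0, |r_i| - 2)` attained by finite presentations of `G`. -/
def presLengthValues (G : Type*) [Group G] : Set ℕ :=
  { t | ∃ (n : ℕ) (rels : List (FreeGroup (Fin n))),
      Nonempty (G ≃* PresentedGroup {r | r ∈ rels}) ∧
      t = (rels.map (fun r => FreeGroup.norm r - 2)).sum }

/-- A group is finitely presentable if it admits a finite presentation. -/
def FinitelyPresentable (G : Type*) [Group G] : Prop :=
  (presLengthValues G).Nonempty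

/-- The presentation length (Delzant's T-invariant) of a group. -/
noncomputable def presLength (G : Type*) [Group G] : ℕ :=
  sInf (presLengthValues G)

/-- The stable presentation length of a group. -/
noncomputable def stablePresLength (G : Type*) [Group G] : ℝ :=
  sInf { x : ℝ | ∃ H : Subgroup G, H.index ≠ 0 ∧
      x = (presLength H : ℝ) / (H.index : ℝ) }

theorem presLengthValues_congr {G G' : Type*} [Group G] [Group G'] (e : G ≃* G') :
    presLengthValues G = presLengthValues G' := by
  ext t
  constructor
  · rintro ⟨n, rels, ⟨f⟩, ht⟩
    exact ⟨n, rels, ⟨e.symm.trans f⟩, ht⟩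
  · rintro ⟨n, rels, ⟨f⟩, ht⟩
    exact ⟨n, rels, ⟨e.trans f⟩, ht⟩

/-- The presentation length is an isomorphism invariant. -/
theorem presLength_congr {G G' : Type*} [Group G] [Group G'] (e : G ≃* G') :
    presLength G = presLength G' := by
  rw [presLength, presLength, presLengthValues_congr e]

/-- A group isomorphic to one of its subgroups `H` contains isomorphic copies of itself of
index `H.index ^ n` for every `n`. -/
theorem Subgroup.exists_index_eq_pow_of_mulEquiv {G : Type*} [Group G] (H : Subgroup G)
    (e : H ≃* G) (n : ℕ) :
    ∃ K : Subgroup G, K.index = H.index ^ n ∧ Nonempty (K ≃* G) := by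
  let f : G →* G := H.subtype.comp e.symm.toMonoidHom
  have hf : Function.Injective f := H.subtype_injective.comp e.symm.injective
  have hrange : f.range = H := by
    rw [MonoidHom.range_comp, MonoidHom.range_eq_top.mpr e.symm.surjective,
      ← MonoidHom.range_eq_map, H.range_subtype]
  induction n with
  | zero => exact ⟨⊤, by simp, ⟨Subgroup.topEquiv⟩⟩
  | succ n ih =>
    obtain ⟨K, hK, ⟨g⟩⟩ := ih
    refine ⟨K.map f, ?_, ⟨(K.equivMapOfInjective f hf).symm.trans g⟩⟩
    rw [Subgroup.index_map_of_injective K hf, hrange, hK, pow_succ]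

/-- If a finitely presentable group has a proper finite-index subgroup isomorphic to
itself, then its stable presentation length vanishes. -/
theorem stablePresLength_eq_zero_of_selfSimilar (G : Type*) [Group G]
    (hG : FinitelyPresentable G) (H : Subgroup G) (d : ℕ) (hd : 2 ≤ d)
    (hindex : H.index = d) (hiso : Nonempty (H ≃* G)) :
    stablePresLength G = 0 := by
  obtain ⟨e⟩ := hiso
  have hnonneg : ∀ x ∈ {x : ℝ | ∃ K : Subgroup G, K.index ≠ 0 ∧
      x = (presLength K : ℝ) / (K.index : ℝ)}, 0 ≤ x := by
    rintro x ⟨K, -, rfl⟩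
    positivity
  refine le_antisymm ?_ (Real.sInf_nonneg hnonneg)
  have hlim : Filter.Tendsto (fun n : ℕ => (presLength G : ℝ) / (d : ℝ) ^ n)
      Filter.atTop (nhds 0) :=
    tendsto_const_nhds.div_atTop
      (tendsto_pow_atTop_atTop_of_one_lt (by exact_mod_cast hd))
  refine ge_of_tendsto' hlim fun n => csInf_le ⟨0, hnonneg⟩ ?_
  obtain ⟨K, hK, ⟨g⟩⟩ := H.exists_index_eq_pow_of_mulEquiv e n
  rw [hindex] at hK
  refine ⟨K, ?_, ?_⟩
  · rw [hK]
    positivity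
  · rw [hK, presLength_congr g, Nat.cast_pow]
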